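/- Let 1 ≤ s < r ≤ ∞. Then for every real-linear map T on the real vector space H_n of n×n complex Hermitian matrices, ‖T‖_{r→s} ≤ 2√2 · ‖T‖_{∞→∞}^{1−1/s} · ‖T‖_{r/s→1}^{1/s}, with the conventions 1/∞ = 0 and r/s = ∞ when r = ∞. -/

import Mathlib

open scoped ENNReal

/-- The spectral `p`-norm of a Hermitian matrix: the `p`-norm of its eigenvalue vector.
(Junk value `0` for non-Hermitian matrices.) -/
noncomputable def specPNorm {n : ℕ} (p : ℝ≥0∞) (A : Matrix (Fin n) (Fin n) ℂ) : ℝ :=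
  if hA : A.IsHermitian then
    (if p = ∞ then ⨆ i, |hA.eigenvalues i|
     else (∑ i, |hA.eigenvalues i| ^ p.toReal) ^ (1 / p.toReal))
  else 0

/-- The operator norm of a real-linear map on Hermitian matrices (represented as a real-linear
map on all matrices), from the spectral `r`-norm to the spectral `s`-norm: the supremum of
`‖T A‖_s / ‖A‖_r` over nonzero Hermitian `A`. -/
noncomputable def hermOpNorm {n : ℕ} (r s : ℝ≥0∞)
    (T : Matrix (Fin n) (Fin n) ℂ →ₗ[ℝ] Matrix (Fin n) (Fin n) ℂ) : ℝ :=
  ⨆ A : {A : Matrix (Fin n) (Fin n) ℂ // A.IsHermitian ∧ A ≠ 0},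
    specPNorm s (T A.1) / specPNorm r A.1

open Matrix

/-- The entire function `z ↦ sign(a) |a| ^ z`, identically zero for `a = 0`. -/
noncomputable def signedPow (a : ℝ) (z : ℂ) : ℂ :=
  (Real.sign a : ℂ) * Complex.exp (z * (Real.log a : ℂ))

lemma abs_sign_le_one (a : ℝ) : |Real.sign a| ≤ 1 := by
  rcases Real.sign_apply_eq a with h | h | h <;> simp [h]

lemma norm_signedPow_le (a : ℝ) (z : ℂ) : ‖signedPow a z‖ ≤ |a| ^ z.re := by
  by_cases ha : a = 0
  · subst ha
    simpa [signedPow] using Real.rpow_nonneg le_rfl z.re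
  · rw [signedPow, norm_mul, Complex.norm_exp, Complex.norm_real, Real.norm_eq_abs,
      Real.rpow_def_of_pos (abs_pos.2 ha), Real.log_abs, mul_comm (Real.log a)]
    simpa using mul_le_of_le_one_left (Real.exp_nonneg (z.re * Real.log a)) (abs_sign_le_one a)

lemma norm_signedPow_le_exp {a c : ℝ} {z : ℂ} (hz : |z.re| ≤ c) :
    ‖signedPow a z‖ ≤ Real.exp (c * |Real.log a|) := by
  rw [signedPow, norm_mul, Complex.norm_exp, Complex.norm_real, Real.norm_eq_abs]
  refine (mul_le_of_le_one_left (Real.exp_nonneg _) (abs_sign_le_one a)).trans ?_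
  gcongr
  simp only [Complex.mul_re, Complex.ofReal_re, Complex.ofReal_im, mul_zero, sub_zero]
  exact (le_abs_self _).trans (by rw [abs_mul]; gcongr)

lemma signedPow_ofReal (a t : ℝ) (ha : a ≠ 0) :
    signedPow a t = ((Real.sign a * |a| ^ t : ℝ) : ℂ) := by
  rw [signedPow, Real.rpow_def_of_pos (abs_pos.2 ha), Real.log_abs, mul_comm (Real.log a)]
  push_cast
  rfl

lemma signedPow_one (a : ℝ) : signedPow a 1 = a := by
  by_cases ha : a = 0
  · simp [signedPow, ha]
  · have h := signedPow_ofReal a 1 ha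
    rw [Complex.ofReal_one] at h
    rw [h, Real.rpow_one]
    rcases lt_or_gt_of_ne ha with h | h
    · simp [Real.sign_of_neg h, abs_of_neg h]
    · simp [Real.sign_of_pos h, abs_of_pos h]

lemma signedPow_sub_one_mul (a : ℝ) {s : ℝ} (hs : s ≠ 0) :
    signedPow a ((s - 1 : ℝ) : ℂ) * (a : ℂ) = ((|a| ^ s : ℝ) : ℂ) := by
  by_cases ha : a = 0
  · simp [signedPow, ha, Real.zero_rpow hs]
  · rw [signedPow_ofReal a _ ha, ← Complex.ofReal_mul]
    congr 1
    have h1 : Real.sign a * a = |a| := by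
      rcases lt_or_gt_of_ne ha with h | h
      · simp [Real.sign_of_neg h, abs_of_neg h]
      · simp [Real.sign_of_pos h, abs_of_pos h]
    rw [mul_right_comm, h1, Real.rpow_sub_one (abs_pos.2 ha).ne']
    field_simp [abs_pos.2 ha]

lemma differentiable_signedPow (a : ℝ) : Differentiable ℂ (signedPow a) := by
  unfold signedPow
  fun_prop

lemma norm_sum_ofReal_mul_le_re_add_im {ι : Type*} [Fintype ι] (m : ι → ℝ) (u : ι → ℂ) :
    ‖∑ j, (m j : ℂ) * u j‖ ≤ |∑ j, m j * (u j).re| + |∑ j, m j * (u j).im| := by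
  simpa using Complex.norm_le_abs_re_add_abs_im (∑ j, (m j : ℂ) * u j)

/-- Interpolation between `ℓ^∞ → ℓ^∞` and `ℓ^(r/s) → ℓ^1` bounds for a real matrix. The second
bound is only required on the order interval determined by `|x| ^ s`. -/
theorem sum_rpow_le_of_bounds {ι : Type*} [Fintype ι] (M : ι → ι → ℝ) {s : ℝ} (hs : 1 < s)
    (x : ι → ℝ) {K₀ K₁ : ℝ} (hK₀ : 0 ≤ K₀) (hK₁ : 0 ≤ K₁)
    (h₀ : ∀ u : ι → ℝ, (∀ j, |u j| ≤ 1) → ∀ i, |∑ j, M i j * u j| ≤ K₀)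
    (h₁ : ∀ u : ι → ℝ, (∀ j, |u j| ≤ |x j| ^ s) → ∑ i, |∑ j, M i j * u j| ≤ K₁) :
    (∑ i, |∑ j, M i j * x j| ^ s) ^ (1 / s) ≤ 2 * K₀ ^ (1 - 1 / s) * K₁ ^ (1 / s) := by
  have hs0 : 0 < s := one_pos.trans hs
  set w : ι → ℝ := fun i => ∑ j, M i j * x j with hw
  set W : ℝ := ∑ i, |w i| ^ s with hW
  have hW0 : 0 ≤ W := Finset.sum_nonneg fun i _ => by positivity
  let f : ℂ → ℂ := fun z =>
    ∑ i, signedPow (w i) (s * (1 - z)) * ∑ j, (M i j : ℂ) * signedPow (x j) (s * z)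
  have hf : Differentiable ℂ f := by
    have h := differentiable_signedPow
    unfold f
    refine Differentiable.fun_sum fun i _ => Differentiable.mul ?_
      (Differentiable.fun_sum fun j _ => Differentiable.mul ?_ ?_)
    · exact (h _).comp (by fun_prop)
    · fun_prop
    · exact (h _).comp (by fun_prop)
  have hre : ∀ z : ℂ, ((s : ℂ) * z).re = s * z.re := fun z => by simp
  have hbdd : BddAbove ((norm ∘ f) '' Complex.HadamardThreeLines.verticalClosedStrip 0 1) := by
    refine ⟨∑ i, Real.exp (s * |Real.log (w i)|) *
      ∑ j, |M i j| * Real.exp (s * |Real.log (x j)|), ?_⟩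
    rintro _ ⟨z, hz, rfl⟩
    obtain ⟨hz0, hz1⟩ : 0 ≤ z.re ∧ z.re ≤ 1 := hz
    refine (norm_sum_le _ _).trans (Finset.sum_le_sum fun i _ => ?_)
    rw [norm_mul]
    gcongr
    · refine norm_signedPow_le_exp ?_
      rw [hre, Complex.sub_re, Complex.one_re, abs_of_nonneg (by nlinarith)]
      nlinarith
    · refine (norm_sum_le _ _).trans (Finset.sum_le_sum fun j _ => ?_)
      rw [norm_mul, Complex.norm_real, Real.norm_eq_abs]
      gcongr
      refine norm_signedPow_le_exp ?_
      rw [hre, abs_of_nonneg (by nlinarith)]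
      nlinarith
  have hleft : ∀ z ∈ Complex.re ⁻¹' {0}, ‖f z‖ ≤ W * (2 * K₀) := by
    intro z hz
    have hz : z.re = 0 := hz
    rw [hW, Finset.sum_mul]
    refine (norm_sum_le _ _).trans (Finset.sum_le_sum fun i _ => ?_)
    rw [norm_mul]
    have hu : ∀ j, ‖signedPow (x j) (s * z)‖ ≤ 1 := fun j => by
      simpa [hz] using norm_signedPow_le (x j) (s * z)
    gcongr
    · simpa [hz] using norm_signedPow_le (w i) (s * (1 - z))
    · refine (norm_sum_ofReal_mul_le_re_add_im _ _).trans ?_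
      have a := h₀ (fun j => (signedPow (x j) (s * z)).re)
        (fun j => (Complex.abs_re_le_norm _).trans (hu j)) i
      have b := h₀ (fun j => (signedPow (x j) (s * z)).im)
        (fun j => (Complex.abs_im_le_norm _).trans (hu j)) i
      linarith
  have hright : ∀ z ∈ Complex.re ⁻¹' {1}, ‖f z‖ ≤ 2 * K₁ := by
    intro z hz
    have hz : z.re = 1 := hz
    have hu : ∀ j, ‖signedPow (x j) (s * z)‖ ≤ |x j| ^ s := fun j => by
      simpa [hz] using norm_signedPow_le (x j) (s * z)
    have a := h₁ (fun j => (signedPow (x j) (s * z)).re)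
      (fun j => (Complex.abs_re_le_norm _).trans (hu j))
    have b := h₁ (fun j => (signedPow (x j) (s * z)).im)
      (fun j => (Complex.abs_im_le_norm _).trans (hu j))
    refine le_trans ((norm_sum_le _ _).trans (Finset.sum_le_sum fun i _ => ?_))
      ((Finset.sum_add_distrib.le.trans (add_le_add a b)).trans (two_mul K₁).ge)
    rw [norm_mul]
    refine (mul_le_of_le_one_left (norm_nonneg _) ?_).trans (norm_sum_ofReal_mul_le_re_add_im _ _)
    simpa [hz] using norm_signedPow_le (w i) (s * (1 - z))
  have hθ : ((1 / s : ℝ) : ℂ) ∈ Complex.HadamardThreeLines.verticalClosedStrip 0 1 := by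
    refine ⟨?_, ?_⟩
    · rw [Complex.ofReal_re]; positivity
    · rw [Complex.ofReal_re, div_le_one hs0]; exact hs.le
  have hfθ : f ((1 / s : ℝ) : ℂ) = (W : ℂ) := by
    have e1 : (s : ℂ) * ((1 / s : ℝ) : ℂ) = 1 := by
      rw [← Complex.ofReal_mul, mul_one_div_cancel hs0.ne', Complex.ofReal_one]
    have e2 : (s : ℂ) * (1 - ((1 / s : ℝ) : ℂ)) = ((s - 1 : ℝ) : ℂ) := by
      rw [mul_sub, e1]; push_cast; ring
    simp only [f, e1, e2, signedPow_one, hW, Complex.ofReal_sum]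
    refine Finset.sum_congr rfl fun i _ => ?_
    rw [← signedPow_sub_one_mul (w i) hs0.ne', hw]
    push_cast
    rfl
  have key := Complex.HadamardThreeLines.norm_le_interp_of_mem_verticalClosedStrip₀₁' f hθ
    hf.diffContOnCl hbdd hleft hright
  rw [hfθ, Complex.ofReal_re, Complex.norm_real, Real.norm_of_nonneg hW0] at key
  have e : (W * (2 * K₀)) ^ (1 - 1 / s) * (2 * K₁) ^ (1 / s) =
      W ^ (1 - 1 / s) * (2 * K₀ ^ (1 - 1 / s) * K₁ ^ (1 / s)) := by
    have h2 : (2 : ℝ) ^ (1 - 1 / s) * 2 ^ (1 / s) = 2 := by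
      rw [← Real.rpow_add two_pos]; simp
    rw [Real.mul_rpow hW0 (by positivity), Real.mul_rpow two_pos.le hK₀,
      Real.mul_rpow two_pos.le hK₁]
    linear_combination W ^ (1 - 1 / s) * K₀ ^ (1 - 1 / s) * K₁ ^ (1 / s) * h2
  rw [e] at key
  rcases hW0.eq_or_lt with h | h
  · rw [← h, Real.zero_rpow (by positivity)]
    positivity
  · have hp : 0 < W ^ (1 - 1 / s) := by positivity
    refine le_of_mul_le_mul_left ?_ hp
    rwa [← Real.rpow_add h, sub_add_cancel, Real.rpow_one]

/-- The `p`-norm of a real vector, with the supremum for `p = ∞`. -/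
noncomputable def vecPNorm {ι : Type*} [Fintype ι] (p : ℝ≥0∞) (v : ι → ℝ) : ℝ :=
  if p = ∞ then ⨆ i, |v i| else (∑ i, |v i| ^ p.toReal) ^ (1 / p.toReal)

section vecPNorm

variable {ι : Type*} [Fintype ι]

lemma vecPNorm_nonneg (p : ℝ≥0∞) (v : ι → ℝ) : 0 ≤ vecPNorm p v := by
  unfold vecPNorm
  split_ifs
  · exact Real.iSup_nonneg fun i => abs_nonneg _
  · positivity

lemma vecPNorm_one (v : ι → ℝ) : vecPNorm 1 v = ∑ i, |v i| := by
  simp [vecPNorm]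

lemma abs_le_vecPNorm {p : ℝ≥0∞} (hp : p ≠ 0) (v : ι → ℝ) (i : ι) : |v i| ≤ vecPNorm p v := by
  unfold vecPNorm
  split_ifs with h
  · exact le_ciSup (f := fun i => |v i|) (Set.finite_range _).bddAbove i
  · have hp' : 0 < p.toReal := ENNReal.toReal_pos hp h
    calc |v i| = (|v i| ^ p.toReal) ^ (1 / p.toReal) := by
          rw [one_div, Real.rpow_rpow_inv (abs_nonneg _) hp'.ne']
      _ ≤ _ := by
          gcongr
          exact Finset.single_le_sum (f := fun i => |v i| ^ p.toReal)
            (fun i _ => by positivity) (Finset.mem_univ i)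

lemma vecPNorm_top_le {v : ι → ℝ} {c : ℝ} (hc : 0 ≤ c) (h : ∀ i, |v i| ≤ c) :
    vecPNorm ∞ v ≤ c := by
  simpa [vecPNorm] using Real.iSup_le h hc

lemma vecPNorm_mono (p : ℝ≥0∞) {u v : ι → ℝ} (h : ∀ i, |u i| ≤ |v i|) :
    vecPNorm p u ≤ vecPNorm p v := by
  by_cases hp : p = ∞
  · subst hp
    exact vecPNorm_top_le (vecPNorm_nonneg _ _)
      fun i => (h i).trans (abs_le_vecPNorm ENNReal.top_ne_zero v i)
  · simp only [vecPNorm, if_neg hp]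
    gcongr (∑ i, ?_ ^ _) ^ _ with i
    exact h i

lemma vecPNorm_congr_map (p : ℝ≥0∞) {u v : ι → ℝ}
    (h : Multiset.map u Finset.univ.val = Multiset.map v Finset.univ.val) :
    vecPNorm p u = vecPNorm p v := by
  unfold vecPNorm
  split_ifs
  · have hr : Set.range u = Set.range v := by
      ext a
      simpa using congrArg (a ∈ ·) h
    have e : ∀ t : ι → ℝ, ⨆ i, |t i| = sSup (abs '' Set.range t) := fun t => by
      rw [← Set.range_comp]; rfl
    rw [e, e, hr]
  · have hr := congrArg (fun m => (Multiset.map (fun a : ℝ => |a| ^ p.toReal) m).sum) h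
    simp only [Multiset.map_map, Function.comp_def] at hr
    congr 1

lemma vecPNorm_div_le {r s : ℝ≥0∞} (hs0 : s ≠ 0) (hs : s ≠ ∞) (hr0 : r ≠ 0) {u v : ι → ℝ}
    (h : ∀ i, |u i| ≤ |v i| ^ s.toReal) :
    vecPNorm (r / s) u ≤ vecPNorm r v ^ s.toReal := by
  have hs' : 0 < s.toReal := ENNReal.toReal_pos hs0 hs
  by_cases hr : r = ∞
  · subst hr
    rw [ENNReal.top_div_of_ne_top hs]
    refine vecPNorm_top_le (Real.rpow_nonneg (vecPNorm_nonneg _ _) _) fun i => (h i).trans ?_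
    gcongr
    exact abs_le_vecPNorm ENNReal.top_ne_zero v i
  · have hr' : 0 < r.toReal := ENNReal.toReal_pos hr0 hr
    have hrs : r / s ≠ ∞ := ENNReal.div_ne_top hr hs0
    refine (vecPNorm_mono (v := fun i => |v i| ^ s.toReal) _ fun i => ?_).trans_eq ?_
    · exact (h i).trans (le_abs_self _)
    · simp only [vecPNorm, if_neg hr, if_neg hrs, ENNReal.toReal_div]
      rw [← Real.rpow_mul (by positivity)]
      congr 1
      · refine Finset.sum_congr rfl fun i _ => ?_
        rw [abs_of_nonneg (by positivity), ← Real.rpow_mul (abs_nonneg _)]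
        congr 1
        field_simp
      · field_simp

end vecPNorm

section Spectral

variable {n : ℕ}

lemma specPNorm_of_isHermitian (p : ℝ≥0∞) {A : Matrix (Fin n) (Fin n) ℂ} (hA : A.IsHermitian) :
    specPNorm p A = vecPNorm p hA.eigenvalues := by
  rw [specPNorm, dif_pos hA, vecPNorm]

lemma specPNorm_nonneg (p : ℝ≥0∞) (A : Matrix (Fin n) (Fin n) ℂ) : 0 ≤ specPNorm p A := by
  by_cases hA : A.IsHermitian
  · rw [specPNorm_of_isHermitian p hA]
    exact vecPNorm_nonneg _ _
  · rw [specPNorm, dif_neg hA]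

lemma hermOpNorm_nonneg (r s : ℝ≥0∞)
    (T : Matrix (Fin n) (Fin n) ℂ →ₗ[ℝ] Matrix (Fin n) (Fin n) ℂ) : 0 ≤ hermOpNorm r s T :=
  Real.iSup_nonneg fun _ => div_nonneg (specPNorm_nonneg _ _) (specPNorm_nonneg _ _)

/-- The Hermitian matrix `U diag(v) U*`. -/
noncomputable def diagConj (U : Matrix.unitaryGroup (Fin n) ℂ) :
    (Fin n → ℝ) →ₗ[ℝ] Matrix (Fin n) (Fin n) ℂ where
  toFun v := (U : Matrix (Fin n) (Fin n) ℂ) * diagonal (fun i => (v i : ℂ)) *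
    star (U : Matrix (Fin n) (Fin n) ℂ)
  map_add' u v := by
    rw [← add_mul, ← mul_add, diagonal_add]
    simp
  map_smul' c v := by
    have : diagonal (fun i => (((c • v) i : ℝ) : ℂ)) = c • diagonal (fun i => (v i : ℂ)) := by
      rw [← diagonal_smul]
      congr 1
      ext i
      simp
    rw [this]
    simp

lemma diagConj_apply (U : Matrix.unitaryGroup (Fin n) ℂ) (v : Fin n → ℝ) :
    diagConj U v = (U : Matrix (Fin n) (Fin n) ℂ) * diagonal (fun i => (v i : ℂ)) *
      star (U : Matrix (Fin n) (Fin n) ℂ) := rfl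

lemma diagConj_isHermitian (U : Matrix.unitaryGroup (Fin n) ℂ) (v : Fin n → ℝ) :
    (diagConj U v).IsHermitian := by
  rw [diagConj_apply, star_eq_conjTranspose]
  refine isHermitian_mul_mul_conjTranspose _ ?_
  rw [isHermitian_diagonal_iff]
  intro i
  exact Complex.conj_ofReal _

lemma diagConj_eigenvalues {A : Matrix (Fin n) (Fin n) ℂ} (hA : A.IsHermitian) :
    diagConj hA.eigenvectorUnitary hA.eigenvalues = A := by
  conv_rhs => rw [hA.spectral_theorem, Unitary.conjStarAlgAut_apply]
  rfl

lemma specPNorm_diagConj (p : ℝ≥0∞) (U : Matrix.unitaryGroup (Fin n) ℂ) (v : Fin n → ℝ) :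
    specPNorm p (diagConj U v) = vecPNorm p v := by
  have hA := diagConj_isHermitian U v
  rw [specPNorm_of_isHermitian p hA]
  refine vecPNorm_congr_map p ?_
  have h1 := hA.roots_charpoly_eq_eigenvalues
  have h2 : (diagConj U v).charpoly.roots =
      Multiset.map (fun i => (v i : ℂ)) Finset.univ.val := by
    rw [diagConj_apply, charpoly_mul_comm, ← mul_assoc, Unitary.coe_star_mul_self, one_mul,
      charpoly_diagonal, Polynomial.roots_prod]
    · simp
    · simp [Finset.prod_ne_zero_iff, Polynomial.X_sub_C_ne_zero]
  rw [h2] at h1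
  have h3 := congrArg (Multiset.map Complex.re) h1
  simpa [Multiset.map_map, Function.comp_def] using h3.symm

/-- The real diagonal of `B` in the orthonormal basis given by the columns of `V`. -/
noncomputable def pinch (V : Matrix.unitaryGroup (Fin n) ℂ) :
    Matrix (Fin n) (Fin n) ℂ →ₗ[ℝ] (Fin n → ℝ) where
  toFun B i := ((star (V : Matrix (Fin n) (Fin n) ℂ) * B * V) i i).re
  map_add' A B := by
    ext i
    simp [mul_add, add_mul]
  map_smul' c B := by
    ext i
    simp

lemma pinch_apply (V : Matrix.unitaryGroup (Fin n) ℂ) (B : Matrix (Fin n) (Fin n) ℂ)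
    (i : Fin n) : pinch V B i = ((star (V : Matrix (Fin n) (Fin n) ℂ) * B * V) i i).re := rfl

lemma pinch_diagConj (V U : Matrix.unitaryGroup (Fin n) ℂ) (v : Fin n → ℝ) (i : Fin n) :
    pinch V (diagConj U v) i =
      ∑ k, ‖((star V * U : Matrix.unitaryGroup (Fin n) ℂ) : Matrix (Fin n) (Fin n) ℂ) i k‖ ^ 2 *
        v k := by
  set W : Matrix.unitaryGroup (Fin n) ℂ := star V * U with hW
  have e : star (V : Matrix (Fin n) (Fin n) ℂ) * diagConj U v * V =
      (W : Matrix (Fin n) (Fin n) ℂ) * diagonal (fun i => (v i : ℂ)) *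
        star (W : Matrix (Fin n) (Fin n) ℂ) := by
    rw [diagConj_apply, hW]
    simp [mul_assoc]
  rw [pinch_apply, e, mul_apply, Complex.re_sum]
  refine Finset.sum_congr rfl fun k _ => ?_
  rw [mul_diagonal, star_apply, mul_right_comm, Complex.star_def, Complex.mul_conj,
    Complex.normSq_eq_norm_sq, ← Complex.ofReal_mul, Complex.ofReal_re]

lemma sum_norm_sq_row (W : Matrix.unitaryGroup (Fin n) ℂ) (i : Fin n) :
    ∑ k, ‖(W : Matrix (Fin n) (Fin n) ℂ) i k‖ ^ 2 = 1 := by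
  have h := congrFun (congrFun (Unitary.coe_mul_star_self W) i) i
  rw [mul_apply, one_apply_eq] at h
  have h' := congrArg Complex.re h
  simpa [Complex.mul_conj, Complex.normSq_eq_norm_sq, ← Complex.ofReal_pow] using h'

lemma sum_norm_sq_col (W : Matrix.unitaryGroup (Fin n) ℂ) (k : Fin n) :
    ∑ i, ‖(W : Matrix (Fin n) (Fin n) ℂ) i k‖ ^ 2 = 1 := by
  simpa using sum_norm_sq_row (star W) k

lemma abs_pinch_le (V : Matrix.unitaryGroup (Fin n) ℂ) {B : Matrix (Fin n) (Fin n) ℂ}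
    (hB : B.IsHermitian) (i : Fin n) : |pinch V B i| ≤ specPNorm ∞ B := by
  rw [specPNorm_of_isHermitian _ hB]
  conv_lhs => rw [← diagConj_eigenvalues hB]
  rw [pinch_diagConj]
  refine (Finset.abs_sum_le_sum_abs _ _).trans ?_
  rw [← one_mul (vecPNorm _ _), ← sum_norm_sq_row (star V * hB.eigenvectorUnitary) i,
    Finset.sum_mul]
  refine Finset.sum_le_sum fun k _ => ?_
  rw [abs_mul, abs_of_nonneg (by positivity)]
  gcongr
  exact abs_le_vecPNorm ENNReal.top_ne_zero _ k

lemma sum_abs_pinch_le (V : Matrix.unitaryGroup (Fin n) ℂ) {B : Matrix (Fin n) (Fin n) ℂ}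
    (hB : B.IsHermitian) : ∑ i, |pinch V B i| ≤ specPNorm 1 B := by
  rw [specPNorm_of_isHermitian _ hB, vecPNorm_one]
  conv_lhs => rw [← diagConj_eigenvalues hB]
  simp_rw [pinch_diagConj]
  refine (Finset.sum_le_sum fun i _ => Finset.abs_sum_le_sum_abs _ _).trans ?_
  rw [Finset.sum_comm]
  refine Finset.sum_le_sum fun k _ => ?_
  simp_rw [abs_mul]
  rw [← Finset.sum_mul]
  refine (mul_le_of_le_one_left (abs_nonneg _) ?_)
  simp_rw [abs_of_nonneg (sq_nonneg ‖_‖)]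
  exact (sum_norm_sq_col _ k).le

lemma pinch_eigenvectorUnitary {B : Matrix (Fin n) (Fin n) ℂ} (hB : B.IsHermitian) :
    pinch hB.eigenvectorUnitary B = hB.eigenvalues := by
  ext i
  have h : pinch hB.eigenvectorUnitary B i =
      pinch hB.eigenvectorUnitary (diagConj hB.eigenvectorUnitary hB.eigenvalues) i := by
    rw [diagConj_eigenvalues hB]
  rw [h, pinch_diagConj]
  simp [one_apply, apply_ite norm, ite_pow]

lemma norm_mul_mul_apply_le {U B W : Matrix (Fin n) (Fin n) ℂ} {c : ℝ}
    (hU : ∀ i j, ‖U i j‖ ≤ 1) (hW : ∀ i j, ‖W i j‖ ≤ 1) (hB : ∀ i j, ‖B i j‖ ≤ c)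
    (i j : Fin n) : ‖(U * B * W) i j‖ ≤ n * (n * c) := by
  have h : ∀ k, ‖(U * B) i k * W k j‖ ≤ n * c := fun k => by
    rw [norm_mul]
    refine (mul_le_of_le_one_right (norm_nonneg _) (hW k j)).trans ?_
    rw [mul_apply]
    refine (norm_sum_le_of_le _ fun l _ => ?_).trans_eq (b := ∑ _ : Fin n, c) (by simp)
    rw [norm_mul]
    exact (mul_le_of_le_one_left (norm_nonneg _) (hU i l)).trans (hB l k)
  rw [mul_apply]
  exact (norm_sum_le_of_le _ fun k _ => h k).trans_eq (by simp)

lemma LinearMap.exists_norm_apply_le_of_finiteDimensional {V : Type*} [NormedAddCommGroup V]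
    [NormedSpace ℝ V] [FiniteDimensional ℝ V] (T : V →ₗ[ℝ] V) :
    ∃ C : ℝ, 0 ≤ C ∧ ∀ v, ‖T v‖ ≤ C * ‖v‖ :=
  ⟨‖T.toContinuousLinearMap‖, norm_nonneg _, T.toContinuousLinearMap.le_opNorm⟩

lemma exists_specPNorm_one_le {p : ℝ≥0∞} (hp : p ≠ 0)
    (T : Matrix (Fin n) (Fin n) ℂ →ₗ[ℝ] Matrix (Fin n) (Fin n) ℂ)
    (hT : ∀ A : Matrix (Fin n) (Fin n) ℂ, A.IsHermitian → (T A).IsHermitian) :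
    ∃ C : ℝ, ∀ A : Matrix (Fin n) (Fin n) ℂ, A.IsHermitian →
      specPNorm 1 (T A) ≤ C * specPNorm p A := by
  let : NormedAddCommGroup (Matrix (Fin n) (Fin n) ℂ) := Matrix.normedAddCommGroup
  let : NormedSpace ℝ (Matrix (Fin n) (Fin n) ℂ) := Matrix.normedSpace
  obtain ⟨C, hC0, hC⟩ := LinearMap.exists_norm_apply_le_of_finiteDimensional T
  refine ⟨n * (n * (n * (C * (n * n)))), fun A hA => ?_⟩
  have hAn : ‖A‖ ≤ n * (n * specPNorm p A) := by
    have h0 := specPNorm_nonneg p A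
    refine (Matrix.norm_le_iff (by positivity)).2 fun i j => ?_
    conv_lhs => rw [← diagConj_eigenvalues hA]
    refine norm_mul_mul_apply_le (entry_norm_bound_of_unitary (SetLike.coe_mem _))
      (entry_norm_bound_of_unitary (Unitary.star_mem (SetLike.coe_mem _))) (fun k l => ?_) i j
    rw [diagonal_apply]
    split_ifs
    · rw [Complex.norm_real, specPNorm_of_isHermitian p hA]
      exact abs_le_vecPNorm hp _ k
    · simpa using h0
  have hB := hT A hA
  rw [specPNorm_of_isHermitian 1 hB, vecPNorm_one]
  have hle : ∀ i, |hB.eigenvalues i| ≤ n * (n * (C * (n * (n * specPNorm p A)))) := fun i => by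
    rw [← pinch_eigenvectorUnitary hB, pinch_apply]
    refine (Complex.abs_re_le_norm _).trans (norm_mul_mul_apply_le
      (entry_norm_bound_of_unitary (Unitary.star_mem (SetLike.coe_mem _)))
      (entry_norm_bound_of_unitary (SetLike.coe_mem _)) (fun k l => ?_) i i)
    exact (Matrix.norm_entry_le_entrywise_sup_norm _).trans ((hC A).trans (by gcongr))
  refine (Finset.sum_le_sum fun i _ => hle i).trans_eq ?_
  simp
  ring

lemma specPNorm_top_le_one {B : Matrix (Fin n) (Fin n) ℂ} (hB : B.IsHermitian) :
    specPNorm ∞ B ≤ specPNorm 1 B := by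
  rw [specPNorm_of_isHermitian _ hB, specPNorm_of_isHermitian _ hB]
  exact vecPNorm_top_le (vecPNorm_nonneg _ _) (abs_le_vecPNorm one_ne_zero _)

lemma specPNorm_le_hermOpNorm_mul {p q : ℝ≥0∞} (hp : p ≠ 0) (hq : q = 1 ∨ q = ∞)
    (T : Matrix (Fin n) (Fin n) ℂ →ₗ[ℝ] Matrix (Fin n) (Fin n) ℂ)
    (hT : ∀ A : Matrix (Fin n) (Fin n) ℂ, A.IsHermitian → (T A).IsHermitian)
    {A : Matrix (Fin n) (Fin n) ℂ} (hA : A.IsHermitian) :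
    specPNorm q (T A) ≤ hermOpNorm p q T * specPNorm p A := by
  obtain ⟨C, hC⟩ := exists_specPNorm_one_le hp T hT
  have hC' : ∀ A : Matrix (Fin n) (Fin n) ℂ, A.IsHermitian →
      specPNorm q (T A) ≤ C * specPNorm p A := fun A hA => by
    rcases hq with rfl | rfl
    · exact hC A hA
    · exact (specPNorm_top_le_one (hT A hA)).trans (hC A hA)
  rcases (specPNorm_nonneg p A).eq_or_lt with h0 | h0
  · have := hC' A hA
    rwa [← h0, mul_zero] at this ⊢
  · have hA0 : A ≠ 0 := by
      rintro rfl
      have e : specPNorm p (diagConj (1 : Matrix.unitaryGroup (Fin n) ℂ) 0) = 0 := by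
        rw [specPNorm_diagConj]
        by_cases hp' : p = ∞
        · simp [vecPNorm, hp']
        · have := ENNReal.toReal_pos hp hp'
          simp [vecPNorm, hp', Real.zero_rpow this.ne', this.ne']
      rw [map_zero] at e
      exact h0.ne' e
    rw [← div_le_iff₀ h0]
    refine le_ciSup (f := fun A : {A : Matrix (Fin n) (Fin n) ℂ // A.IsHermitian ∧ A ≠ 0} =>
      specPNorm q (T A.1) / specPNorm p A.1) ⟨max C 0, ?_⟩ ⟨A, hA, hA0⟩
    rintro _ ⟨⟨B, hB, -⟩, rfl⟩
    refine div_le_of_le_mul₀ (specPNorm_nonneg _ _) (le_max_right _ _) ((hC' B hB).trans ?_)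
    gcongr
    · exact specPNorm_nonneg _ _
    · exact le_max_left _ _

lemma specPNorm_le_interp {r s : ℝ≥0∞} (hs : 1 < s) (hs' : s ≠ ∞) (hr : r ≠ 0)
    (T : Matrix (Fin n) (Fin n) ℂ →ₗ[ℝ] Matrix (Fin n) (Fin n) ℂ)
    (hT : ∀ A : Matrix (Fin n) (Fin n) ℂ, A.IsHermitian → (T A).IsHermitian)
    {A : Matrix (Fin n) (Fin n) ℂ} (hA : A.IsHermitian) :
    specPNorm s (T A) ≤ 2 * hermOpNorm ∞ ∞ T ^ (1 - 1 / s.toReal) *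
      hermOpNorm (r / s) 1 T ^ (1 / s.toReal) * specPNorm r A := by
  have hs0 : s ≠ 0 := (zero_lt_one.trans hs).ne'
  have hst : 1 < s.toReal := by
    simpa using (ENNReal.toReal_lt_toReal ENNReal.one_ne_top hs').2 hs
  have hB := hT A hA
  have hrs : r / s ≠ 0 := (ENNReal.div_pos hr hs').ne'
  set x := hA.eigenvalues with hx
  set N := specPNorm r A with hN
  have hN0 : 0 ≤ N := specPNorm_nonneg _ _
  set L : (Fin n → ℝ) →ₗ[ℝ] (Fin n → ℝ) :=
    pinch hB.eigenvectorUnitary ∘ₗ T ∘ₗ diagConj hA.eigenvectorUnitary with hL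
  have hLv : ∀ u i, ∑ j, L (Pi.single j 1) i * u j = L u i := fun u i => by
    conv_rhs => rw [pi_eq_sum_univ' u]
    simp [mul_comm]
  have hLx : L x = hB.eigenvalues := by
    simp only [hL, LinearMap.comp_apply, hx, diagConj_eigenvalues hA]
    exact pinch_eigenvectorUnitary hB
  have hK₀ := hermOpNorm_nonneg ∞ ∞ T
  have hK₁ := hermOpNorm_nonneg (r / s) 1 T
  have hD := diagConj_isHermitian hA.eigenvectorUnitary
  have key := sum_rpow_le_of_bounds (fun i j => L (Pi.single j 1) i) hst x (K₀ := hermOpNorm ∞ ∞ T)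
    (K₁ := hermOpNorm (r / s) 1 T * N ^ s.toReal) hK₀ (by positivity)
    (fun u hu i => by
      rw [hLv]
      refine (abs_pinch_le _ (hT _ (hD u)) i).trans
        ((specPNorm_le_hermOpNorm_mul ENNReal.top_ne_zero (.inr rfl) T hT (hD u)).trans ?_)
      rw [specPNorm_diagConj]
      exact mul_le_of_le_one_right hK₀ (vecPNorm_top_le zero_le_one hu))
    (fun u hu => by
      simp only [hLv]
      refine (sum_abs_pinch_le _ (hT _ (hD u))).trans
        ((specPNorm_le_hermOpNorm_mul hrs (.inl rfl) T hT (hD u)).trans ?_)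
      rw [specPNorm_diagConj, hN, specPNorm_of_isHermitian r hA]
      gcongr
      exact vecPNorm_div_le hs0 hs' hr hu)
  simp only [hLv, hLx] at key
  rw [specPNorm_of_isHermitian s hB, vecPNorm, if_neg hs']
  refine key.trans_eq ?_
  rw [Real.mul_rpow hK₁ (by positivity), one_div, Real.rpow_rpow_inv hN0 (by positivity)]
  ring

end Spectral

/-- Corollary 3.2, case `r > s`, in the algebra of Hermitian matrices:
`‖T‖_{r→s} ≤ 2√2 ‖T‖_{∞→∞}^{1-1/s} ‖T‖_{r/s→1}^{1/s}`. -/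
theorem corollary_s_lt_r {n : ℕ} (r s : ℝ≥0∞) (hs : 1 ≤ s) (hsr : s < r)
    (T : Matrix (Fin n) (Fin n) ℂ →ₗ[ℝ] Matrix (Fin n) (Fin n) ℂ)
    (hT : ∀ A : Matrix (Fin n) (Fin n) ℂ, A.IsHermitian → (T A).IsHermitian) :
    hermOpNorm r s T ≤
      2 * Real.sqrt 2 * hermOpNorm ∞ ∞ T ^ (1 - (1 / s).toReal) *
        hermOpNorm (r / s) 1 T ^ (1 / s).toReal := by
  have hs' : s ≠ ∞ := hsr.ne_top
  have hr : r ≠ 0 := (zero_le.trans_lt hsr).ne'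
  have hK₀ := hermOpNorm_nonneg ∞ ∞ T
  have hK₁ := hermOpNorm_nonneg (r / s) 1 T
  have h2 : (1 : ℝ) ≤ Real.sqrt 2 := Real.one_le_sqrt.2 one_le_two
  refine Real.iSup_le (fun A => ?_) (by positivity)
  obtain ⟨A, hA, -⟩ := A
  have hN := specPNorm_nonneg r A
  refine div_le_of_le_mul₀ hN (by positivity) ?_
  rcases hs.eq_or_lt with rfl | hs
  · have h := specPNorm_le_hermOpNorm_mul hr (.inl rfl) T hT hA
    have hK := hermOpNorm_nonneg r 1 T
    simp only [div_one, ENNReal.toReal_one, sub_self, Real.rpow_zero, mul_one, Real.rpow_one]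
    refine h.trans ?_
    gcongr
    exact le_mul_of_one_le_left hK (by linarith)
  · rw [ENNReal.toReal_div, ENNReal.toReal_one]
    refine (specPNorm_le_interp hs hs' hr T hT hA).trans ?_
    gcongr
    linarith
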